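/- Let D be a domain-independent, union-closed k-ary dependency. Then D is strongly first order if and only if D is definable in terms of constancy atoms, nonemptiness atoms and global disjunctions; that is, if and only if there exists a formula φ(w⃗) of FO(=(·), NE, ⊔) (over the empty signature, with w⃗ a k-tuple of variables) such that for all models M and all teams X over M whose domain contains w⃗: M ⊨_X D w⃗ iff M ⊨_X φ(w⃗). -/

import Mathlib

open FirstOrder FirstOrder.Language

/-- A `k`-ary dependency: an isomorphism-closed class of models `(A, R)` where `R` is a
`k`-ary relation on the domain `A`. -/
structure Dependency (k : ℕ) : Type 1 where
  Mem : ∀ (A : Type), Set (Fin k → A) → Prop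
  iso_closed : ∀ {A B : Type} (e : A ≃ B) (R : Set (Fin k → A)),
    Mem A R → Mem B ((fun (t : Fin k → A) (i : Fin k) => e (t i)) '' R)

/-- `Fld R` is the set of all elements occurring in some position of some tuple of `R`. -/
def Fld {k : ℕ} {A : Type} (R : Set (Fin k → A)) : Set A :=
  {a | ∃ t ∈ R, ∃ i, t i = a}

/-- A dependency is domain independent if `(A, R) ∈ D ↔ (Fld R, R) ∈ D`. -/
def Dependency.DomainIndependent {k : ℕ} (D : Dependency k) : Prop :=
  ∀ (A : Type) (R : Set (Fin k → A)),
    D.Mem A R ↔ D.Mem (Fld R) {t : Fin k → (Fld R) | (fun i => (t i : A)) ∈ R}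

/-- A dependency is union closed if it is closed under unions of arbitrary
(possibly empty) families of relations on a fixed domain. -/
def Dependency.UnionClosed {k : ℕ} (D : Dependency k) : Prop :=
  ∀ (A : Type) (I : Type) (R : I → Set (Fin k → A)),
    (∀ i, D.Mem A (R i)) → D.Mem A (⋃ i, R i)

def Dependency.DownwardsClosed {k : ℕ} (D : Dependency k) : Prop :=
  ∀ (A : Type) (R S : Set (Fin k → A)), D.Mem A R → S ⊆ R → D.Mem A S

def Dependency.UpwardsClosed {k : ℕ} (D : Dependency k) : Prop :=
  ∀ (A : Type) (R S : Set (Fin k → A)), D.Mem A R → R ⊆ S → D.Mem A S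

def Dependency.EmptyTeamProperty {k : ℕ} (D : Dependency k) : Prop :=
  ∀ A : Type, D.Mem A (∅ : Set (Fin k → A))

/-- `teamMap X xs` is `X(x⃗)`: the set of values of the tuple of variables `xs` over the team `X`. -/
def teamMap {M : Type} (X : Set (ℕ → M)) {n : ℕ} (xs : Fin n → ℕ) : Set (Fin n → M) :=
  {t | ∃ s ∈ X, t = fun j => s (xs j)}

/-- Formulas of `FO(𝒟)` in negation normal form, over the language `L`, with variables in `ℕ`,
where `𝒟` is the family of dependencies `(Ds i)_{i : ι}`. -/
inductive TSFormula (L : FirstOrder.Language.{0,0}) {ι : Type} (Ds : ι → (k : ℕ) × Dependency k) : Type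
  | rel {n : ℕ} (r : L.Relations n) (ts : Fin n → L.Term ℕ)
  | nrel {n : ℕ} (r : L.Relations n) (ts : Fin n → L.Term ℕ)
  | equal (t₁ t₂ : L.Term ℕ)
  | nequal (t₁ t₂ : L.Term ℕ)
  | depAtom (i : ι) (xs : Fin (Ds i).1 → ℕ)
  | conj (φ ψ : TSFormula L Ds)
  | disj (φ ψ : TSFormula L Ds)
  | ex (v : ℕ) (φ : TSFormula L Ds)
  | fa (v : ℕ) (φ : TSFormula L Ds)

variable {L : FirstOrder.Language.{0,0}} {ι : Type} {Ds : ι → (k : ℕ) × Dependency k}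

/-- Team semantics for `FO(𝒟)`. -/
def TSFormula.Sat (M : Type) [L.Structure M] : TSFormula L Ds → Set (ℕ → M) → Prop
  | .rel r ts, X => ∀ s ∈ X, Structure.RelMap r (fun i => (ts i).realize s)
  | .nrel r ts, X => ∀ s ∈ X, ¬ Structure.RelMap r (fun i => (ts i).realize s)
  | .equal t₁ t₂, X => ∀ s ∈ X, t₁.realize s = t₂.realize s
  | .nequal t₁ t₂, X => ∀ s ∈ X, t₁.realize s ≠ t₂.realize s
  | .depAtom i xs, X => (Ds i).2.Mem M (teamMap X xs)
  | .conj φ ψ, X => φ.Sat M X ∧ ψ.Sat M X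
  | .disj φ ψ, X => ∃ Y Z : Set (ℕ → M), X = Y ∪ Z ∧ φ.Sat M Y ∧ ψ.Sat M Z
  | .ex v φ, X => ∃ H : (ℕ → M) → Set M, (∀ s ∈ X, (H s).Nonempty) ∧
      φ.Sat M {s' | ∃ s ∈ X, ∃ m ∈ H s, s' = Function.update s v m}
  | .fa v φ, X => φ.Sat M {s' | ∃ s ∈ X, ∃ m : M, s' = Function.update s v m}

/-- The set of variables of a first-order term. -/
def termVars : L.Term ℕ → Set ℕ
  | .var x => {x}
  | .func _f ts => ⋃ i, termVars (ts i)

/-- The free variables of a team-semantics formula. -/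
def TSFormula.freeVars : TSFormula L Ds → Set ℕ
  | .rel _ ts => ⋃ i, termVars (ts i)
  | .nrel _ ts => ⋃ i, termVars (ts i)
  | .equal t₁ t₂ => termVars t₁ ∪ termVars t₂
  | .nequal t₁ t₂ => termVars t₁ ∪ termVars t₂
  | .depAtom _ xs => Set.range xs
  | .conj φ ψ => φ.freeVars ∪ ψ.freeVars
  | .disj φ ψ => φ.freeVars ∪ ψ.freeVars
  | .ex v φ => φ.freeVars \ {v}
  | .fa v φ => φ.freeVars \ {v}

/-- A sentence of `FO(𝒟)` is true in `M` iff it is satisfied by the team containing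
only one assignment (for sentences, the choice of assignment is irrelevant). -/
def TSFormula.TrueIn (M : Type) [L.Structure M] (φ : TSFormula L Ds) : Prop :=
  ∀ s : ℕ → M, φ.Sat M {s}

/-- A family of dependencies is strongly first order iff every sentence of `FO(𝒟)`,
over any (Type-0) signature, is equivalent to some first-order sentence. -/
def StronglyFirstOrderFamily {ι : Type} (Ds : ι → (k : ℕ) × Dependency k) : Prop :=
  ∀ (L : FirstOrder.Language.{0,0}) (φ : TSFormula L Ds), φ.freeVars = ∅ →
    ∃ ψ : L.Sentence, ∀ (M : Type) [L.Structure M] [Nonempty M],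
      (φ.TrueIn M ↔ Sentence.Realize M ψ)

/-- A single dependency is strongly first order iff every sentence of `FO(D)`
is equivalent to some first-order sentence. -/
def StronglyFirstOrder {k : ℕ} (D : Dependency k) : Prop :=
  StronglyFirstOrderFamily (fun _ : Unit => ⟨k, D⟩)

/-- Formulas of `FO(=(·), NE, ⊔)`: first-order logic with team semantics (in negation normal
form) over the language `L`, extended by constancy atoms `=(x⃗)`, nonemptiness atoms `NE(x⃗)`,
and global (Boolean) disjunctions `⊔`. -/
inductive CNFormula (L : FirstOrder.Language.{0,0}) : Type
  | rel {n : ℕ} (r : L.Relations n) (ts : Fin n → L.Term ℕ)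
  | nrel {n : ℕ} (r : L.Relations n) (ts : Fin n → L.Term ℕ)
  | equal (t₁ t₂ : L.Term ℕ)
  | nequal (t₁ t₂ : L.Term ℕ)
  | constancy (n : ℕ) (xs : Fin n → ℕ)
  | neAtom (n : ℕ) (xs : Fin n → ℕ)
  | conj (φ ψ : CNFormula L)
  | disj (φ ψ : CNFormula L)
  | glob (φ ψ : CNFormula L)
  | ex (v : ℕ) (φ : CNFormula L)
  | fa (v : ℕ) (φ : CNFormula L)

variable {L : FirstOrder.Language.{0,0}}

/-- Team semantics for `FO(=(·), NE, ⊔)`. -/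
def CNFormula.Sat (M : Type) [L.Structure M] : CNFormula L → Set (ℕ → M) → Prop
  | .rel r ts, X => ∀ s ∈ X, Structure.RelMap r (fun i => (ts i).realize s)
  | .nrel r ts, X => ∀ s ∈ X, ¬ Structure.RelMap r (fun i => (ts i).realize s)
  | .equal t₁ t₂, X => ∀ s ∈ X, t₁.realize s = t₂.realize s
  | .nequal t₁ t₂, X => ∀ s ∈ X, t₁.realize s ≠ t₂.realize s
  | .constancy _ xs, X => ∀ s ∈ X, ∀ s' ∈ X, ∀ j, s (xs j) = s' (xs j)
  | .neAtom _ xs, X => (teamMap X xs).Nonempty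
  | .conj φ ψ, X => φ.Sat M X ∧ ψ.Sat M X
  | .disj φ ψ, X => ∃ Y Z : Set (ℕ → M), X = Y ∪ Z ∧ φ.Sat M Y ∧ ψ.Sat M Z
  | .glob φ ψ, X => φ.Sat M X ∨ ψ.Sat M X
  | .ex v φ, X => ∃ H : (ℕ → M) → Set M, (∀ s ∈ X, (H s).Nonempty) ∧
      φ.Sat M {s' | ∃ s ∈ X, ∃ m ∈ H s, s' = Function.update s v m}
  | .fa v φ, X => φ.Sat M {s' | ∃ s ∈ X, ∃ m : M, s' = Function.update s v m}

/-- The set of variables of a first-order term. -/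
def cnTermVars : L.Term ℕ → Set ℕ
  | .var x => {x}
  | .func _f ts => ⋃ i, cnTermVars (ts i)

/-- The free variables of a formula of `FO(=(·), NE, ⊔)`. -/
def CNFormula.freeVars : CNFormula L → Set ℕ
  | .rel _ ts => ⋃ i, cnTermVars (ts i)
  | .nrel _ ts => ⋃ i, cnTermVars (ts i)
  | .equal t₁ t₂ => cnTermVars t₁ ∪ cnTermVars t₂
  | .nequal t₁ t₂ => cnTermVars t₁ ∪ cnTermVars t₂
  | .constancy _ xs => Set.range xs
  | .neAtom _ xs => Set.range xs
  | .conj φ ψ => φ.freeVars ∪ ψ.freeVars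
  | .disj φ ψ => φ.freeVars ∪ ψ.freeVars
  | .glob φ ψ => φ.freeVars ∪ ψ.freeVars
  | .ex v φ => φ.freeVars \ {v}
  | .fa v φ => φ.freeVars \ {v}

instance (M : Type) : FirstOrder.Language.empty.Structure M := Language.emptyStructure

/-- A clause of the normal form for team properties: for some values of the parameters
(the right summand of the variables), all assignments satisfy `all`, and each formula of `some`
is satisfied by some assignment. -/
structure TeamClause (L : FirstOrder.Language.{0,0}) where
  all : L.Formula (ℕ ⊕ ℕ)
  some : List (L.Formula (ℕ ⊕ ℕ))

namespace TeamClause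

def HoldsAt (C : TeamClause L) {M : Type} [L.Structure M] (X : Set (ℕ → M)) (p : ℕ → M) : Prop :=
  (∀ s ∈ X, C.all.Realize (Sum.elim s p)) ∧ ∀ h ∈ C.some, ∃ s ∈ X, h.Realize (Sum.elim s p)

/-- Rename the parameters of a clause. -/
def reparam (C : TeamClause L) (g : ℕ → ℕ) : TeamClause L :=
  ⟨C.all.relabel (Sum.map id g), C.some.map (fun h => h.relabel (Sum.map id g))⟩

theorem holdsAt_reparam {C : TeamClause L} {g : ℕ → ℕ} {M : Type} [L.Structure M]
    {X : Set (ℕ → M)} {p : ℕ → M} : (C.reparam g).HoldsAt X p ↔ C.HoldsAt X (p ∘ g) := by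
  simp [HoldsAt, reparam, Formula.realize_relabel, Sum.elim_comp_map]

theorem exists_holdsAt_and {C₁ C₂ : TeamClause L} {M : Type} [L.Structure M]
    {X Y : Set (ℕ → M)} :
    (∃ p, (C₁.reparam (fun n => 2 * n)).HoldsAt X p ∧
      (C₂.reparam (fun n => 2 * n + 1)).HoldsAt Y p) ↔
      (∃ p, C₁.HoldsAt X p) ∧ ∃ p, C₂.HoldsAt Y p := by
  simp only [holdsAt_reparam]
  constructor
  · rintro ⟨p, h₁, h₂⟩
    exact ⟨⟨_, h₁⟩, ⟨_, h₂⟩⟩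
  · rintro ⟨⟨p, hp⟩, ⟨q, hq⟩⟩
    refine ⟨fun n => if n % 2 = 0 then p (n / 2) else q (n / 2), ?_, ?_⟩
    · convert hp using 1
      funext n
      simp
    · convert hq using 1
      funext n
      have h₁ : (2 * n + 1) % 2 = 1 := by omega
      have h₂ : (2 * n + 1) / 2 = n := by omega
      simp [h₁, h₂]

end TeamClause

/-- A property of teams is first-order clausal if it is a finite disjunction of clauses, uniformly
in all nonempty structures. -/
def TeamClausal (L : FirstOrder.Language.{0,0})
    (P : ∀ (M : Type) [L.Structure M], Set (ℕ → M) → Prop) : Prop :=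
  ∃ l : List (TeamClause L), ∀ (M : Type) [L.Structure M] [Nonempty M] (X : Set (ℕ → M)),
    P M X ↔ ∃ C ∈ l, ∃ p, C.HoldsAt X p

theorem FirstOrder.Language.Formula.exists_realize_iff_exists_update {α : Type} [DecidableEq α]
    (ψ : L.Formula α) (v : α) : ∃ ψ' : L.Formula α, ∀ (M : Type) [L.Structure M] (s : α → M),
      ψ'.Realize s ↔ ∃ m, ψ.Realize (Function.update s v m) := by
  refine ⟨(ψ.relabel (fun x => if x = v then Sum.inr () else Sum.inl x) :
    L.Formula (α ⊕ Unit)).iExs Unit, fun M _ s => ?_⟩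
  rw [Formula.realize_iExs]
  have key : ∀ i : Unit → M,
      Sum.elim s i ∘ (fun x => if x = v then Sum.inr () else Sum.inl x) =
        Function.update s v (i ()) := by
    intro i
    funext x
    by_cases h : x = v
    · subst h; simp
    · simp [h]
  simp only [Formula.realize_relabel, key]
  exact ⟨fun ⟨i, hi⟩ => ⟨_, hi⟩, fun ⟨m, hm⟩ => ⟨fun _ => m, hm⟩⟩

theorem FirstOrder.Language.Formula.exists_realize_iff_forall_update {α : Type} [DecidableEq α]
    (ψ : L.Formula α) (v : α) : ∃ ψ' : L.Formula α, ∀ (M : Type) [L.Structure M] (s : α → M),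
      ψ'.Realize s ↔ ∀ m, ψ.Realize (Function.update s v m) := by
  obtain ⟨ψ', h⟩ := Formula.exists_realize_iff_exists_update ψ.not v
  exact ⟨ψ'.not, fun M _ s => by simp [h]⟩

/-- Existential closure over infinitely many variables: only finitely many occur. -/
theorem FirstOrder.Language.Formula.exists_realize_iff_exists_elim {α β : Type}
    (ψ : L.Formula (α ⊕ β)) : ∃ ψ' : L.Formula α,
      ∀ (M : Type) [L.Structure M] [Nonempty M] (s : α → M),
        ψ'.Realize s ↔ ∃ p : β → M, ψ.Realize (Sum.elim s p) := by
  classical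
  let F := ψ.freeVarFinset
  let f : F → α ⊕ F := fun x => match h : x.1 with
    | Sum.inl a => Sum.inl a
    | Sum.inr b => Sum.inr x
  refine ⟨Formula.iExs F (ψ.restrictFreeVar f), fun M _ _ s => ?_⟩
  rw [Formula.realize_iExs]
  constructor
  · rintro ⟨i, hi⟩
    refine ⟨fun b => if h : Sum.inr b ∈ F then i ⟨_, h⟩ else Classical.arbitrary M, ?_⟩
    refine (BoundedFormula.realize_restrictFreeVar _ ?_).1 hi
    rintro ⟨a | b, h⟩
    · simp [f]
    · have hb : Sum.inr b ∈ F := h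
      simp [f, hb]
  · rintro ⟨p, hp⟩
    refine ⟨fun x => Sum.elim s p x.1, ?_⟩
    refine (BoundedFormula.realize_restrictFreeVar _ ?_).2 hp
    rintro ⟨a | b, h⟩
    · simp [f]
    · simp [f]

namespace TeamClausal

variable {P Q : ∀ (M : Type) [L.Structure M], Set (ℕ → M) → Prop}

theorem of_clause (C : TeamClause L) (h : ∀ (M : Type) [L.Structure M] [Nonempty M]
    (X : Set (ℕ → M)), P M X ↔ ∃ p, C.HoldsAt X p) : TeamClausal L P :=
  ⟨[C], fun M _ _ X => by simp [h]⟩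

theorem flat (θ : L.Formula ℕ) (h : ∀ (M : Type) [L.Structure M] [Nonempty M]
    (X : Set (ℕ → M)), P M X ↔ ∀ s ∈ X, θ.Realize s) : TeamClausal L P :=
  of_clause ⟨θ.relabel Sum.inl, []⟩ fun M _ _ X => by
    simp [h, TeamClause.HoldsAt, Formula.realize_relabel]

theorem or (hP : TeamClausal L P) (hQ : TeamClausal L Q) :
    TeamClausal L (fun M _ X => P M X ∨ Q M X) := by
  obtain ⟨l, hl⟩ := hP
  obtain ⟨l', hl'⟩ := hQ
  refine ⟨l ++ l', fun M _ _ X => ?_⟩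
  simp only [hl, hl', List.mem_append, or_and_right, exists_or]

/-- Combine two disjunctions of clauses clause by clause, with disjoint parameters. -/
theorem combine (hP : TeamClausal L P) (hQ : TeamClausal L Q)
    (c : TeamClause L → TeamClause L → TeamClause L)
    (R : ∀ M : Type, Set (ℕ → M) → Set (ℕ → M) → Set (ℕ → M) → Prop)
    (hc : ∀ (C C' : TeamClause L) (M : Type) [L.Structure M] (X : Set (ℕ → M)) (p : ℕ → M),
      (c C C').HoldsAt X p ↔ ∃ Y Z, R M X Y Z ∧ C.HoldsAt Y p ∧ C'.HoldsAt Z p) :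
    TeamClausal L (fun M _ X => ∃ Y Z, R M X Y Z ∧ P M Y ∧ Q M Z) := by
  obtain ⟨l, hl⟩ := hP
  obtain ⟨l', hl'⟩ := hQ
  refine ⟨(l ×ˢ l').map (fun C => c (C.1.reparam (fun n => 2 * n))
    (C.2.reparam (fun n => 2 * n + 1))), fun M _ _ X => ?_⟩
  simp only [hl, hl', List.mem_map, List.mem_product, Prod.exists]
  constructor
  · rintro ⟨Y, Z, hR, ⟨C, hC, hCp⟩, ⟨C', hC', hCp'⟩⟩
    obtain ⟨p, hp, hp'⟩ := TeamClause.exists_holdsAt_and.2 ⟨hCp, hCp'⟩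
    exact ⟨_, ⟨C, C', ⟨hC, hC'⟩, rfl⟩, p, (hc _ _ _ _ _).2 ⟨Y, Z, hR, hp, hp'⟩⟩
  · rintro ⟨_, ⟨C, C', ⟨hC, hC'⟩, rfl⟩, p, hp⟩
    obtain ⟨Y, Z, hR, hY, hZ⟩ := (hc _ _ _ _ _).1 hp
    obtain ⟨h₁, h₂⟩ := TeamClause.exists_holdsAt_and.1 ⟨p, hY, hZ⟩
    exact ⟨Y, Z, hR, ⟨C, hC, h₁⟩, ⟨C', hC', h₂⟩⟩

theorem and (hP : TeamClausal L P) (hQ : TeamClausal L Q) :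
    TeamClausal L (fun M _ X => P M X ∧ Q M X) := by
  have := combine hP hQ (fun C C' => ⟨C.all ⊓ C'.all, C.some ++ C'.some⟩)
    (fun M X Y Z => Y = X ∧ Z = X) (fun C C' M _ X p => by
      simp only [TeamClause.HoldsAt, Formula.realize_inf, List.mem_append, and_assoc,
        exists_and_left, exists_eq_left]
      grind)
  simpa [and_assoc] using this

theorem split (hP : TeamClausal L P) (hQ : TeamClausal L Q) :
    TeamClausal L (fun M _ X => ∃ Y Z, X = Y ∪ Z ∧ P M Y ∧ Q M Z) := by
  refine combine hP hQ (fun C C' => ⟨C.all ⊔ C'.all,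
    C.some.map (fun h => C.all ⊓ h) ++ C'.some.map (fun h => C'.all ⊓ h)⟩)
    (fun M X Y Z => X = Y ∪ Z) (fun C C' M _ X p => ?_)
  simp only [TeamClause.HoldsAt, Formula.realize_sup, List.mem_append, List.mem_map]
  constructor
  · rintro ⟨h₁, h₂⟩
    refine ⟨{s ∈ X | C.all.Realize (Sum.elim s p)}, {s ∈ X | C'.all.Realize (Sum.elim s p)},
      ?_, ⟨fun s hs => hs.2, fun h hh => ?_⟩, ⟨fun s hs => hs.2, fun h hh => ?_⟩⟩
    · ext s
      have := h₁ s
      simp only [Set.mem_union, Set.mem_ofPred_eq]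
      tauto
    · obtain ⟨s, hs, hs'⟩ := h₂ _ (Or.inl ⟨h, hh, rfl⟩)
      rw [Formula.realize_inf] at hs'
      exact ⟨s, ⟨hs, hs'.1⟩, hs'.2⟩
    · obtain ⟨s, hs, hs'⟩ := h₂ _ (Or.inr ⟨h, hh, rfl⟩)
      rw [Formula.realize_inf] at hs'
      exact ⟨s, ⟨hs, hs'.1⟩, hs'.2⟩
  · rintro ⟨Y, Z, rfl, ⟨hY, hY'⟩, hZ, hZ'⟩
    refine ⟨fun s hs => hs.imp (hY s) (hZ s), ?_⟩
    rintro _ (⟨h, hh, rfl⟩ | ⟨h, hh, rfl⟩)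
    · obtain ⟨s, hs, hs'⟩ := hY' h hh
      exact ⟨s, Or.inl hs, Formula.realize_inf.2 ⟨hY s hs, hs'⟩⟩
    · obtain ⟨s, hs, hs'⟩ := hZ' h hh
      exact ⟨s, Or.inr hs, Formula.realize_inf.2 ⟨hZ s hs, hs'⟩⟩

/-- Transform each clause without touching its parameters. -/
theorem map (hP : TeamClausal L P) (c : TeamClause L → TeamClause L)
    (R : ∀ M : Type, Set (ℕ → M) → Set (ℕ → M) → Prop)
    (hc : ∀ (C : TeamClause L) (M : Type) [L.Structure M] (X : Set (ℕ → M)) (p : ℕ → M),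
      (c C).HoldsAt X p ↔ ∃ Y, R M X Y ∧ C.HoldsAt Y p) :
    TeamClausal L (fun M _ X => ∃ Y, R M X Y ∧ P M Y) := by
  obtain ⟨l, hl⟩ := hP
  refine ⟨l.map c, fun M _ _ X => ?_⟩
  constructor
  · rintro ⟨Y, hR, hY⟩
    obtain ⟨C, hC, p, hp⟩ := (hl M Y).1 hY
    exact ⟨c C, List.mem_map_of_mem hC, p, (hc C M X p).2 ⟨Y, hR, hp⟩⟩
  · rintro ⟨C', hC', p, hp⟩
    obtain ⟨C, hC, rfl⟩ := List.mem_map.1 hC'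
    obtain ⟨Y, hR, hY⟩ := (hc C M X p).1 hp
    exact ⟨Y, hR, (hl M Y).2 ⟨C, hC, p, hY⟩⟩

theorem update_elim {M : Type} (s p : ℕ → M) (v : ℕ) (m : M) :
    Function.update (Sum.elim s p) (Sum.inl v) m = Sum.elim (Function.update s v m) p :=
  Sum.update_elim_inl

theorem ex (hP : TeamClausal L P) (v : ℕ) :
    TeamClausal L (fun M _ X => ∃ H : (ℕ → M) → Set M, (∀ s ∈ X, (H s).Nonempty) ∧
      P M {s' | ∃ s ∈ X, ∃ m ∈ H s, s' = Function.update s v m}) := by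
  choose E hE using fun ψ : L.Formula (ℕ ⊕ ℕ) =>
    Formula.exists_realize_iff_exists_update ψ (Sum.inl v)
  have := map hP (fun C => ⟨E C.all, C.some.map (fun h => E (C.all ⊓ h))⟩)
    (fun M X Y => ∃ H : (ℕ → M) → Set M, (∀ s ∈ X, (H s).Nonempty) ∧
      Y = {s' | ∃ s ∈ X, ∃ m ∈ H s, s' = Function.update s v m}) (fun C M _ X p => by
    simp only [TeamClause.HoldsAt, hE, List.mem_map, forall_exists_index, and_imp,
      forall_apply_eq_imp_iff₂, Formula.realize_inf, update_elim]
    constructor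
    · rintro ⟨h₁, h₂⟩
      refine ⟨_, ⟨fun s => {m | C.all.Realize (Sum.elim (Function.update s v m) p)}, h₁, rfl⟩,
        ?_, ?_⟩
      · rintro _ ⟨s, hs, m, hm, rfl⟩
        exact hm
      · intro h hh
        obtain ⟨s, hs, m, hm, hm'⟩ := h₂ h hh
        exact ⟨_, ⟨s, hs, m, hm, rfl⟩, hm'⟩
    · rintro ⟨_, ⟨H, hH, rfl⟩, h₁, h₂⟩
      refine ⟨fun s hs => ?_, fun h hh => ?_⟩
      · obtain ⟨m, hm⟩ := hH s hs
        exact ⟨m, h₁ _ ⟨s, hs, m, hm, rfl⟩⟩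
      · obtain ⟨_, ⟨s, hs, m, hm, rfl⟩, hm'⟩ := h₂ h hh
        exact ⟨s, hs, m, h₁ _ ⟨s, hs, m, hm, rfl⟩, hm'⟩)
  obtain ⟨l, hl⟩ := this
  refine ⟨l, fun M _ _ X => Iff.trans ⟨?_, ?_⟩ (hl M X)⟩
  · rintro ⟨H, hH, h⟩
    exact ⟨_, ⟨H, hH, rfl⟩, h⟩
  · rintro ⟨_, ⟨H, hH, rfl⟩, h⟩
    exact ⟨H, hH, h⟩

theorem fa (hP : TeamClausal L P) (v : ℕ) :
    TeamClausal L (fun M _ X => P M {s' | ∃ s ∈ X, ∃ m : M, s' = Function.update s v m}) := by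
  choose E hE using fun ψ : L.Formula (ℕ ⊕ ℕ) =>
    Formula.exists_realize_iff_exists_update ψ (Sum.inl v)
  choose F hF using fun ψ : L.Formula (ℕ ⊕ ℕ) =>
    Formula.exists_realize_iff_forall_update ψ (Sum.inl v)
  have := map hP (fun C => ⟨F C.all, C.some.map E⟩)
    (fun M X Y => Y = {s' | ∃ s ∈ X, ∃ m, s' = Function.update s v m}) (fun C M _ X p => by
    simp only [TeamClause.HoldsAt, hE, hF, update_elim, List.mem_map, forall_exists_index, and_imp,
      forall_apply_eq_imp_iff₂, exists_eq_left, Set.mem_ofPred_eq]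
    refine and_congr ⟨?_, ?_⟩ (forall₂_congr fun h _ => ⟨?_, ?_⟩)
    · rintro h _ s hs m rfl
      exact h s hs m
    · exact fun h s hs m => h _ s hs m rfl
    · rintro ⟨s, hs, m, hm⟩
      exact ⟨_, ⟨s, hs, m, rfl⟩, hm⟩
    · rintro ⟨_, ⟨s, hs, m, rfl⟩, hm⟩
      exact ⟨s, hs, m, hm⟩)
  simpa using this

theorem precomp (hP : TeamClausal L P) (g : ℕ → ℕ) :
    TeamClausal L (fun M _ X => P M ((fun s => s ∘ g) '' X)) := by
  have := map hP (fun C => ⟨C.all.relabel (Sum.map g id),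
      C.some.map (fun h => h.relabel (Sum.map g id))⟩)
    (fun M X Y => Y = (fun s => s ∘ g) '' X) (fun C M _ X p => by
      simp [TeamClause.HoldsAt, Formula.realize_relabel, Sum.elim_comp_map])
  simpa using this

theorem constancy (n : ℕ) (xs : Fin n → ℕ) :
    TeamClausal L (fun _ _ X => ∀ s ∈ X, ∀ s' ∈ X, ∀ j, s (xs j) = s' (xs j)) := by
  refine of_clause ⟨BoundedFormula.iInf (fun j : Fin n =>
    (Term.var (Sum.inl (xs j))).equal (Term.var (Sum.inr (xs j)))), []⟩ fun M _ _ X => ?_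
  have hall : ∀ s p : ℕ → M, Formula.Realize (BoundedFormula.iInf (fun j : Fin n =>
      (Term.var (Sum.inl (xs j))).equal (Term.var (Sum.inr (xs j)))) : L.Formula (ℕ ⊕ ℕ))
      (Sum.elim s p) ↔ ∀ j, s (xs j) = p (xs j) := fun s p =>
    BoundedFormula.realize_iInf.trans (forall_congr' fun j => Formula.realize_equal)
  simp only [TeamClause.HoldsAt, hall, List.not_mem_nil, false_imp_iff, implies_true, and_true]
  constructor
  · intro h
    rcases X.eq_empty_or_nonempty with rfl | ⟨s₀, hs₀⟩
    · simp
    · exact ⟨s₀, fun s hs j => h s hs s₀ hs₀ j⟩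
  · rintro ⟨p, hp⟩ s hs s' hs' j
    rw [hp s hs, hp s' hs']

theorem nonempty : TeamClausal L (fun _ _ X => X.Nonempty) :=
  of_clause ⟨⊤, [⊤]⟩ fun _ _ _ X => by simp [TeamClause.HoldsAt, Set.Nonempty]

/-- On singleton teams, clausal properties define first-order sentences. -/
theorem exists_sentence (hP : TeamClausal L P) : ∃ ψ : L.Sentence,
    ∀ (M : Type) [L.Structure M] [Nonempty M],
      ((∀ s : ℕ → M, P M {s}) ↔ Sentence.Realize M ψ) := by
  obtain ⟨l, hl⟩ := hP
  let χ : L.Formula (ℕ ⊕ ℕ) :=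
    (l.map (fun C => C.all ⊓ C.some.foldr (· ⊓ ·) ⊤)).foldr (· ⊔ ·) ⊥
  have hχ : ∀ (M : Type) [L.Structure M] (s p : ℕ → M),
      χ.Realize (Sum.elim s p) ↔ ∃ C ∈ l, C.HoldsAt {s} p := by
    intro M _ s p
    simp only [χ, Formula.Realize, BoundedFormula.realize_foldr_sup, List.mem_map,
      exists_exists_and_eq_and, BoundedFormula.realize_inf, BoundedFormula.realize_foldr_inf,
      TeamClause.HoldsAt, Set.mem_singleton_iff, forall_eq, exists_eq_left]
  obtain ⟨χ₁, h₁⟩ := Formula.exists_realize_iff_exists_elim χ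
  obtain ⟨χ₂, h₂⟩ := Formula.exists_realize_iff_exists_elim
    (χ₁.not.relabel Sum.inr : L.Formula (Empty ⊕ ℕ))
  refine ⟨χ₂.not, fun M _ _ => ?_⟩
  rw [Sentence.Realize, Formula.realize_not, h₂]
  simp only [Formula.realize_relabel, Sum.elim_comp_inr, Formula.realize_not, not_exists,
    h₁, hχ, hl]
  exact forall_congr' fun s => by grind

end TeamClausal

theorem CNFormula.teamClausal (φ : CNFormula Language.empty) :
    TeamClausal L (fun M _ X => φ.Sat M X) := by
  have hterm : ∀ t : Language.empty.Term ℕ, ∃ x, t = Term.var x := by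
    rintro (x | ⟨f, _⟩)
    · exact ⟨x, rfl⟩
    · exact f.elim
  induction φ with
  | rel r ts => exact r.elim
  | nrel r ts => exact r.elim
  | equal t₁ t₂ =>
    obtain ⟨x, rfl⟩ := hterm t₁
    obtain ⟨y, rfl⟩ := hterm t₂
    exact .flat ((Term.var x).equal (Term.var y)) fun M _ _ X => by
      simp [CNFormula.Sat, Formula.realize_equal]
  | nequal t₁ t₂ =>
    obtain ⟨x, rfl⟩ := hterm t₁
    obtain ⟨y, rfl⟩ := hterm t₂
    exact .flat ((Term.var x).equal (Term.var y)).not fun M _ _ X => by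
      simp [CNFormula.Sat, Formula.realize_equal]
  | constancy n xs => exact .constancy n xs
  | neAtom n xs =>
    obtain ⟨l, hl⟩ := TeamClausal.nonempty (L := L)
    refine ⟨l, fun M _ _ X => Iff.trans ⟨?_, ?_⟩ (hl M X)⟩
    · rintro ⟨_, s, hs, -⟩
      exact ⟨s, hs⟩
    · rintro ⟨s, hs⟩
      exact ⟨_, s, hs, rfl⟩
  | conj φ ψ ihφ ihψ => exact ihφ.and ihψ
  | disj φ ψ ihφ ihψ => exact ihφ.split ihψ
  | glob φ ψ ihφ ihψ => exact ihφ.or ihψ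
  | ex v φ ih => exact ih.ex v
  | fa v φ ih => exact ih.fa v

/-- If `φ` defines the dependency `D`, then all team properties expressible with `D`
are clausal. -/
theorem TSFormula.teamClausal {k : ℕ} {D : Dependency k} {φ : CNFormula Language.empty}
    (hφ : ∀ (M : Type) [Nonempty M] (X : Set (ℕ → M)),
      D.Mem M (teamMap X (fun i : Fin k => (i : ℕ))) ↔ φ.Sat M X)
    (χ : TSFormula L (fun _ : Unit => (⟨k, D⟩ : (k : ℕ) × Dependency k))) :
    TeamClausal L (fun M _ X => χ.Sat M X) := by
  induction χ with
  | rel r ts =>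
    exact .flat (r.formula ts) fun M _ _ X => by
      simp [TSFormula.Sat, Formula.realize_rel]
  | nrel r ts =>
    exact .flat (r.formula ts).not fun M _ _ X => by
      simp [TSFormula.Sat, Formula.realize_rel]
  | equal t₁ t₂ =>
    exact .flat (t₁.equal t₂) fun M _ _ X => by
      simp [TSFormula.Sat, Formula.realize_equal]
  | nequal t₁ t₂ =>
    exact .flat (t₁.equal t₂).not fun M _ _ X => by
      simp [TSFormula.Sat, Formula.realize_equal]
  | depAtom i xs =>
    obtain ⟨l, hl⟩ := (φ.teamClausal (L := L)).precomp
      (fun n => if h : n < k then xs ⟨n, h⟩ else 0)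
    refine ⟨l, fun M _ _ X => Iff.trans ?_ (hl M X)⟩
    refine Iff.trans ?_ (hφ M _)
    have : teamMap ((fun s : ℕ → M => s ∘ fun n => if h : n < k then xs ⟨n, h⟩ else 0) '' X)
        (fun i : Fin k => (i : ℕ)) = teamMap X xs := by
      ext t
      simp [teamMap]
    rw [this]
    rfl
  | conj φ ψ ihφ ihψ => exact ihφ.and ihψ
  | disj φ ψ ihφ ihψ => exact ihφ.split ihψ
  | ex v φ ih => exact ih.ex v
  | fa v φ ih => exact ih.fa v

theorem Dependency.stronglyFirstOrder_of_definable {k : ℕ} {D : Dependency k}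
    {φ : CNFormula Language.empty}
    (hφ : ∀ (M : Type) [Nonempty M] (X : Set (ℕ → M)),
      D.Mem M (teamMap X (fun i : Fin k => (i : ℕ))) ↔ φ.Sat M X) :
    StronglyFirstOrder D :=
  fun _ χ _ => (χ.teamClausal hφ).exists_sentence

namespace Dependency

variable {k : ℕ} {D : Dependency k}

theorem mem_image_equiv_iff {A B : Type} (e : A ≃ B) (R : Set (Fin k → A)) :
    D.Mem B ((fun t i => e (t i)) '' R) ↔ D.Mem A R := by
  refine ⟨fun h => ?_, D.iso_closed e R⟩
  have := D.iso_closed e.symm _ h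
  simpa [Set.image_image] using this

/-- For domain independent dependencies, membership is preserved by injections. -/
theorem DomainIndependent.mem_image_iff (hdi : D.DomainIndependent) {A B : Type} {f : A → B}
    (hf : f.Injective) (R : Set (Fin k → A)) :
    D.Mem B ((fun t i => f (t i)) '' R) ↔ D.Mem A R := by
  rw [hdi B, hdi A]
  let e : Fld R ≃ Fld ((fun t i => f (t i)) '' R) :=
    Equiv.ofBijective (fun a => ⟨f a, by
      obtain ⟨a, t, ht, i, rfl⟩ := a
      exact ⟨_, ⟨t, ht, rfl⟩, i, rfl⟩⟩)
      ⟨fun a b h => Subtype.ext (hf (congrArg Subtype.val h)), by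
        rintro ⟨_, _, ⟨t, ht, rfl⟩, i, rfl⟩
        exact ⟨⟨t i, t, ht, i, rfl⟩, rfl⟩⟩
  rw [← mem_image_equiv_iff e]
  have he : ∀ a, (e a : B) = f a := fun _ => rfl
  congr! 1
  ext t
  constructor
  · rintro ⟨u, hu, hut⟩
    refine ⟨fun i => ⟨u i, u, hu, i, rfl⟩, hu, ?_⟩
    funext i
    exact Subtype.ext (congrFun hut i)
  · rintro ⟨u, hu, rfl⟩
    exact ⟨_, hu, rfl⟩

/-- Membership of a relation named by variables only depends on the equality pattern of the
assignment. -/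
theorem DomainIndependent.mem_image_comp_iff (hdi : D.DomainIndependent) {V M M' : Type}
    {s : V → M} {s' : V → M'} (h : ∀ i j, s i = s j ↔ s' i = s' j) (Γ : Set (Fin k → V)) :
    D.Mem M ((fun γ => s ∘ γ) '' Γ) ↔ D.Mem M' ((fun γ => s' ∘ γ) '' Γ) := by
  have key : ∀ (N : Type) (r : V → N) (_ : Setoid.ker s = Setoid.ker r),
      D.Mem N ((fun γ => r ∘ γ) '' Γ) ↔
        D.Mem (Quotient (Setoid.ker s)) ((fun γ => (Quotient.mk _) ∘ γ) '' Γ) := by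
    intro N r hr
    rw [hr, ← hdi.mem_image_iff (Setoid.kerLift_injective r), Set.image_image]
    rfl
  rw [key M s rfl, key M' s' (Setoid.ext fun i j => h i j)]

end Dependency

/-- `TeamExt S X Y`: the team `Y` arises from `X` by nondeterministically choosing new values, at
least one per assignment, for the variables in `S`. -/
def TeamExt {M : Type} (S : Set ℕ) (X Y : Set (ℕ → M)) : Prop :=
  (∀ s ∈ X, ∃ t ∈ Y, ∀ n ∉ S, t n = s n) ∧ ∀ t ∈ Y, ∃ s ∈ X, ∀ n ∉ S, t n = s n

/-- The team obtained from `X` by giving all possible values to the variables in `S`. -/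
def teamDup {M : Type} (S : Set ℕ) (X : Set (ℕ → M)) : Set (ℕ → M) :=
  {t | ∃ s ∈ X, ∀ n ∉ S, t n = s n}

section

variable {M : Type} {X Y : Set (ℕ → M)}

theorem eq_update_iff_forall_notMem_singleton {s t : ℕ → M} {v : ℕ} :
    t = Function.update s v (t v) ↔ ∀ n ∉ ({v} : Set ℕ), t n = s n := by
  simp [Function.eq_update_iff]

theorem teamExt_empty : TeamExt ∅ X Y ↔ Y = X := by
  have h : ∀ s t : ℕ → M, (∀ n ∉ (∅ : Set ℕ), t n = s n) ↔ t = s := fun s t => by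
    simp [funext_iff]
  simp only [TeamExt, h, exists_eq_right, exists_eq_right']
  exact ⟨fun h => Set.Subset.antisymm h.2 h.1, fun h => h ▸ ⟨fun _ => id, fun _ => id⟩⟩

theorem exists_choice_iff_exists_teamExt {v : ℕ} {P : Set (ℕ → M) → Prop} :
    (∃ H : (ℕ → M) → Set M, (∀ s ∈ X, (H s).Nonempty) ∧
      P {s' | ∃ s ∈ X, ∃ m ∈ H s, s' = Function.update s v m}) ↔
      ∃ Y, TeamExt {v} X Y ∧ P Y := by
  constructor
  · rintro ⟨H, hH, hP⟩
    refine ⟨_, ⟨fun s hs => ?_, ?_⟩, hP⟩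
    · obtain ⟨m, hm⟩ := hH s hs
      exact ⟨_, ⟨s, hs, m, hm, rfl⟩, fun n hn => Function.update_of_ne hn _ _⟩
    · rintro _ ⟨s, hs, m, hm, rfl⟩
      exact ⟨s, hs, fun n hn => Function.update_of_ne hn _ _⟩
  · rintro ⟨Y, ⟨h₁, h₂⟩, hP⟩
    refine ⟨fun s => {m | Function.update s v m ∈ Y}, fun s hs => ?_, ?_⟩
    · obtain ⟨t, ht, hts⟩ := h₁ s hs
      rw [← eq_update_iff_forall_notMem_singleton] at hts
      exact ⟨t v, (hts ▸ ht : Function.update s v (t v) ∈ Y)⟩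
    · convert hP using 1
      ext t
      constructor
      · rintro ⟨s, hs, m, hm, rfl⟩
        exact hm
      · intro ht
        obtain ⟨s, hs, hts⟩ := h₂ t ht
        rw [← eq_update_iff_forall_notMem_singleton] at hts
        exact ⟨s, hs, t v, (hts ▸ ht : Function.update s v (t v) ∈ Y), hts⟩

theorem exists_teamExt_teamExt {S T : Set ℕ} :
    (∃ Z, TeamExt S X Z ∧ TeamExt T Z Y) ↔ TeamExt (S ∪ T) X Y := by
  classical
  constructor
  · rintro ⟨Z, ⟨h₁, h₂⟩, h₃, h₄⟩
    refine ⟨fun s hs => ?_, fun t ht => ?_⟩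
    · obtain ⟨r, hr, hrs⟩ := h₁ s hs
      obtain ⟨t, ht, htr⟩ := h₃ r hr
      refine ⟨t, ht, fun n hn => ?_⟩
      rw [Set.mem_union, not_or] at hn
      rw [htr n hn.2, hrs n hn.1]
    · obtain ⟨r, hr, htr⟩ := h₄ t ht
      obtain ⟨s, hs, hrs⟩ := h₂ r hr
      refine ⟨s, hs, fun n hn => ?_⟩
      rw [Set.mem_union, not_or] at hn
      rw [htr n hn.2, hrs n hn.1]
  · rintro ⟨h₁, h₂⟩
    have key : ∀ s t : ℕ → M, (∀ n ∉ S ∪ T, t n = s n) →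
        ∃ r : ℕ → M, (∀ n ∉ S, r n = s n) ∧ ∀ n ∉ T, t n = r n := fun s t h => by
      refine ⟨fun n => if n ∈ S then t n else s n, fun n hn => by simp [hn], fun n hn => ?_⟩
      by_cases hS : n ∈ S
      · simp [hS]
      · simp [hS, h n (by simp [hS, hn])]
    refine ⟨{r | (∃ s ∈ X, ∀ n ∉ S, r n = s n) ∧ ∃ t ∈ Y, ∀ n ∉ T, t n = r n},
      ⟨fun s hs => ?_, fun r hr => hr.1⟩, fun r hr => hr.2, fun t ht => ?_⟩
    · obtain ⟨t, ht, hts⟩ := h₁ s hs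
      obtain ⟨r, hrs, htr⟩ := key s t hts
      exact ⟨r, ⟨⟨s, hs, hrs⟩, t, ht, htr⟩, hrs⟩
    · obtain ⟨s, hs, hts⟩ := h₂ t ht
      obtain ⟨r, hrs, htr⟩ := key s t hts
      exact ⟨r, ⟨⟨s, hs, hrs⟩, t, ht, htr⟩, htr⟩

theorem teamDup_empty : teamDup ∅ X = X := by
  ext t
  have h : ∀ s : ℕ → M, (∀ n ∉ (∅ : Set ℕ), t n = s n) ↔ t = s := fun s => by
    simp [funext_iff]
  simp only [teamDup, h, Set.mem_ofPred_eq, exists_eq_right']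

theorem teamDup_singleton {v : ℕ} :
    teamDup {v} X = {s' | ∃ s ∈ X, ∃ m : M, s' = Function.update s v m} := by
  ext t
  constructor
  · rintro ⟨s, hs, hts⟩
    exact ⟨s, hs, t v, eq_update_iff_forall_notMem_singleton.2 hts⟩
  · rintro ⟨s, hs, m, rfl⟩
    exact ⟨s, hs, fun n hn => Function.update_of_ne hn _ _⟩

theorem teamDup_teamDup {S T : Set ℕ} : teamDup T (teamDup S X) = teamDup (S ∪ T) X := by
  classical
  ext t
  constructor
  · rintro ⟨r, ⟨s, hs, hrs⟩, htr⟩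
    refine ⟨s, hs, fun n hn => ?_⟩
    rw [Set.mem_union, not_or] at hn
    rw [htr n hn.2, hrs n hn.1]
  · rintro ⟨s, hs, hts⟩
    refine ⟨fun n => if n ∈ S then t n else s n, ⟨s, hs, fun n hn => by simp [hn]⟩,
      fun n hn => ?_⟩
    by_cases hS : n ∈ S
    · simp [hS]
    · simp [hS, hts n (by simp [hS, hn])]

end

namespace TSFormula

theorem sat_foldr_ex {M : Type} [L.Structure M] (vs : List ℕ) (φ : TSFormula L Ds)
    (X : Set (ℕ → M)) :
    (vs.foldr TSFormula.ex φ).Sat M X ↔ ∃ Y, TeamExt {n | n ∈ vs} X Y ∧ φ.Sat M Y := by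
  induction vs generalizing X with
  | nil => simp [teamExt_empty]
  | cons v vs ih =>
    rw [List.foldr_cons, TSFormula.Sat, exists_choice_iff_exists_teamExt]
    have : {n | n ∈ v :: vs} = {v} ∪ {n | n ∈ vs} := by ext; simp
    simp only [ih, this, ← exists_teamExt_teamExt]
    grind

theorem sat_foldr_fa {M : Type} [L.Structure M] (vs : List ℕ) (φ : TSFormula L Ds)
    (X : Set (ℕ → M)) :
    (vs.foldr TSFormula.fa φ).Sat M X ↔ φ.Sat M (teamDup {n | n ∈ vs} X) := by
  induction vs generalizing X with
  | nil => simp [teamDup_empty]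
  | cons v vs ih =>
    have : {n | n ∈ v :: vs} = {v} ∪ {n | n ∈ vs} := by ext; simp
    rw [List.foldr_cons, TSFormula.Sat, ih, ← teamDup_singleton, teamDup_teamDup, this]

theorem freeVars_foldr_ex (vs : List ℕ) (φ : TSFormula L Ds) :
    (vs.foldr TSFormula.ex φ).freeVars = φ.freeVars \ {n | n ∈ vs} := by
  induction vs with
  | nil => simp
  | cons v vs ih =>
    ext n
    simp only [List.foldr_cons, freeVars, ih, Set.mem_sdiff, Set.mem_ofPred_eq,
      Set.mem_singleton_iff, List.mem_cons]
    tauto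

theorem freeVars_foldr_fa (vs : List ℕ) (φ : TSFormula L Ds) :
    (vs.foldr TSFormula.fa φ).freeVars = φ.freeVars \ {n | n ∈ vs} := by
  induction vs with
  | nil => simp
  | cons v vs ih =>
    ext n
    simp only [List.foldr_cons, freeVars, ih, Set.mem_sdiff, Set.mem_ofPred_eq,
      Set.mem_singleton_iff, List.mem_cons]
    tauto

end TSFormula

namespace CNFormula

theorem sat_foldr_ex {M : Type} [L.Structure M] (vs : List ℕ) (φ : CNFormula L)
    (X : Set (ℕ → M)) :
    (vs.foldr CNFormula.ex φ).Sat M X ↔ ∃ Y, TeamExt {n | n ∈ vs} X Y ∧ φ.Sat M Y := by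
  induction vs generalizing X with
  | nil => simp [teamExt_empty]
  | cons v vs ih =>
    rw [List.foldr_cons, CNFormula.Sat, exists_choice_iff_exists_teamExt]
    have : {n | n ∈ v :: vs} = {v} ∪ {n | n ∈ vs} := by ext; simp
    simp only [ih, this, ← exists_teamExt_teamExt]
    grind

theorem freeVars_foldr_ex (vs : List ℕ) (φ : CNFormula L) :
    (vs.foldr CNFormula.ex φ).freeVars = φ.freeVars \ {n | n ∈ vs} := by
  induction vs with
  | nil => simp
  | cons v vs ih =>
    ext n
    simp only [List.foldr_cons, freeVars, ih, Set.mem_sdiff, Set.mem_ofPred_eq,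
      Set.mem_singleton_iff, List.mem_cons]
    tauto

end CNFormula

/-- The relation symbols of the signature with a single relation between `k`-tuples. -/
inductive TupleRel (k : ℕ) : ℕ → Type
  | rel : TupleRel k (k + k)

/-- The signature with a single relation between `k`-tuples. -/
def tupleLang (k : ℕ) : FirstOrder.Language.{0,0} := ⟨fun _ => Empty, TupleRel k⟩

/-- The structure given by a relation between `k`-tuples. -/
@[reducible] def tupleStructure {k : ℕ} {A : Type} (W : (Fin k → A) → (Fin k → A) → Prop) :
    (tupleLang k).Structure A where
  funMap f := f.elim
  RelMap := fun
    | .rel => fun v => W (fun i => v (Fin.castAdd k i)) (fun i => v (Fin.natAdd k i))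

namespace Dependency

variable {k : ℕ} (D : Dependency k)

/-- Some nonempty set of `W`-reflexive tuples has its `W`-image in `D`. -/
def HasImage {A : Type} (W : (Fin k → A) → (Fin k → A) → Prop) : Prop :=
  ∃ Z : Set (Fin k → A), Z.Nonempty ∧ (∀ z ∈ Z, W z z) ∧ D.Mem A {t | ∃ z ∈ Z, W z t}

/-- The sentence expressing `Dependency.HasImage`. -/
def imageSentence : TSFormula (tupleLang k) (fun _ : Unit => (⟨k, D⟩ : (k : ℕ) × Dependency k)) :=
  (List.range k).foldr TSFormula.ex
    (.conj (.rel (n := k + k) TupleRel.rel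
        fun j => Term.var ((Fin.addCases id id j : Fin k) : ℕ))
      (((List.range k).map (k + ·)).foldr TSFormula.fa
        (.disj (.nrel (n := k + k) TupleRel.rel fun j => Term.var (j : ℕ))
          (.conj (.rel (n := k + k) TupleRel.rel fun j => Term.var (j : ℕ))
            (.depAtom () fun i : Fin k => k + (i : ℕ))))))

theorem freeVars_imageSentence : D.imageSentence.freeVars = ∅ := by
  simp only [imageSentence, TSFormula.freeVars_foldr_ex, TSFormula.freeVars_foldr_fa,
    TSFormula.freeVars, termVars]
  ext n
  simp only [Set.mem_sdiff, Set.mem_union, Set.mem_iUnion, Set.mem_singleton_iff, Set.mem_range,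
    Set.mem_ofPred_eq, List.mem_map, List.mem_range, Set.mem_empty_iff_false, iff_false, not_and,
    not_not]
  rintro (⟨j, rfl⟩ | ⟨⟨j, rfl⟩ | ⟨j, rfl⟩ | ⟨j, rfl⟩, h⟩)
  · exact Fin.is_lt _
  · by_contra hj
    exact h ⟨j - k, by omega, by omega⟩
  · by_contra hj
    exact h ⟨j - k, by omega, by omega⟩
  · exact absurd ⟨j, j.2, rfl⟩ h

theorem teamMap_filter_teamDup {A : Type} (W : (Fin k → A) → (Fin k → A) → Prop)
    (Y : Set (ℕ → A)) :
    teamMap {t ∈ teamDup {n | n ∈ (List.range k).map (k + ·)} Y |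
      W (fun i : Fin k => t i) (fun i : Fin k => t (k + i))} (fun i : Fin k => k + (i : ℕ)) =
      {t | ∃ z ∈ teamMap Y (fun i : Fin k => (i : ℕ)), W z t} := by
  ext v
  simp only [teamMap, teamDup, Set.mem_ofPred_eq, List.mem_map, List.mem_range]
  constructor
  · rintro ⟨t, ⟨⟨s, hs, hts⟩, hW⟩, rfl⟩
    refine ⟨_, ⟨s, hs, rfl⟩, ?_⟩
    convert hW using 3 with i
    exact (hts i (by rintro ⟨j, -, hj⟩; omega)).symm
  · rintro ⟨_, ⟨s, hs, rfl⟩, hW⟩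
    refine ⟨fun n => if h : k ≤ n ∧ n - k < k then v ⟨n - k, h.2⟩ else s n,
      ⟨⟨s, hs, fun n hn => ?_⟩, ?_⟩, ?_⟩
    · have : ¬ (k ≤ n ∧ n - k < k) := fun h => hn ⟨n - k, h.2, by omega⟩
      simp [this]
    · have h : ∀ i : Fin k, ¬ (k ≤ (i : ℕ) ∧ (i : ℕ) - k < k) := fun i => by omega
      simpa only [h, dite_false, Nat.le_add_right, Nat.add_sub_cancel_left, Fin.is_lt, and_self,
        dite_true, Fin.eta] using hW
    · simp

theorem trueIn_imageSentence {A : Type} [Nonempty A] (W : (Fin k → A) → (Fin k → A) → Prop) :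
    letI := tupleStructure W
    D.imageSentence.TrueIn A ↔ D.HasImage W := by
  let _ := tupleStructure W
  have hzz : ∀ s : ℕ → A, Structure.RelMap
      (L := tupleLang k) (TupleRel.rel : (tupleLang k).Relations (k + k))
      (fun j : Fin (k + k) => s (Fin.addCases id id j : Fin k)) ↔
        W (fun i : Fin k => s i) (fun i : Fin k => s i) := fun s => by
    change W _ _ ↔ _
    simp only [Fin.addCases_left, Fin.addCases_right, id]
  have hzt : ∀ s : ℕ → A, Structure.RelMap
      (L := tupleLang k) (TupleRel.rel : (tupleLang k).Relations (k + k))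
      (fun j : Fin (k + k) => s j) ↔
        W (fun i : Fin k => s i) (fun i : Fin k => s (k + i)) := fun _ => Iff.rfl
  simp only [TSFormula.TrueIn, imageSentence, TSFormula.sat_foldr_ex, TSFormula.sat_foldr_fa,
    TSFormula.Sat, Term.realize_var, hzz, hzt]
  constructor
  · intro h
    obtain ⟨Y, hY, hYW, Y₁, Y₂, hdup, h₁, h₂, hD⟩ := h (fun _ => Classical.arbitrary A)
    refine ⟨teamMap Y (fun i : Fin k => (i : ℕ)), ?_, ?_, ?_⟩
    · obtain ⟨t, ht, -⟩ := hY.1 _ rfl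
      exact ⟨_, t, ht, rfl⟩
    · rintro _ ⟨t, ht, rfl⟩
      exact hYW t ht
    · rw [← teamMap_filter_teamDup, hdup]
      convert hD using 2
      ext t
      constructor
      · rintro ⟨ht | ht, hW⟩
        · exact absurd hW (h₁ t ht)
        · exact ht
      · exact fun ht => ⟨Or.inr ht, h₂ t ht⟩
  · rintro ⟨Z, ⟨z₀, hz₀⟩, hZW, hD⟩ s
    have hex : ∀ z : Fin k → A, ∃ t : ℕ → A,
        (∀ n ∉ {n | n ∈ List.range k}, t n = s n) ∧ (fun i : Fin k => t i) = z := fun z =>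
      ⟨fun n => if h : n < k then z ⟨n, h⟩ else s n, fun n hn =>
        dif_neg fun h => hn (List.mem_range.2 h), by simp⟩
    let Y : Set (ℕ → A) :=
      {t | (∀ n ∉ {n | n ∈ List.range k}, t n = s n) ∧ (fun i : Fin k => t i) ∈ Z}
    have hYZ : teamMap Y (fun i : Fin k => (i : ℕ)) = Z := by
      ext z
      constructor
      · rintro ⟨t, ht, rfl⟩
        exact ht.2
      · intro hz
        obtain ⟨t, hts, rfl⟩ := hex z
        exact ⟨t, ⟨hts, hz⟩, rfl⟩
    refine ⟨Y, ⟨?_, fun t ht => ⟨s, rfl, ht.1⟩⟩, fun t ht => hZW _ ht.2,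
      {t ∈ teamDup {n | n ∈ (List.range k).map (k + ·)} Y |
        ¬ W (fun i : Fin k => t i) (fun i : Fin k => t (k + i))},
      {t ∈ teamDup {n | n ∈ (List.range k).map (k + ·)} Y |
        W (fun i : Fin k => t i) (fun i : Fin k => t (k + i))}, ?_, fun t ht => ht.2,
      fun t ht => ht.2, ?_⟩
    · rintro _ rfl
      obtain ⟨t, hts, hz⟩ := hex z₀
      exact ⟨t, ⟨hts, hz ▸ hz₀⟩, hts⟩
    · ext t
      simp only [Set.mem_union, Set.mem_ofPred_eq]
      tauto
    · rw [teamMap_filter_teamDup, hYZ]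
      exact hD

end Dependency

section Ultraproduct

variable {k : ℕ} {α : Type} (u : Ultrafilter α) {M : α → Type}

/-- The sequence of `k`-tuples represented by a `k`-tuple of sequences, as a `k`-tuple in the
ultraproduct. -/
def ultraMk (f : ∀ a, Fin k → M a) : Fin k → (u : Filter α).Product M :=
  fun i => ((fun a => f a i : ∀ a, M a) : (u : Filter α).Product M)

variable {u} in
theorem exists_ultraMk_eq (p : Fin k → (u : Filter α).Product M) :
    ∃ f : ∀ a, Fin k → M a, ultraMk u f = p := by
  refine ⟨fun a i => (p i).out a, ?_⟩
  funext i
  exact Quotient.out_eq (p i)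

/-- The ultraproduct of relations between `k`-tuples. -/
def ultraRel (W : ∀ a, (Fin k → M a) → (Fin k → M a) → Prop)
    (p q : Fin k → (u : Filter α).Product M) : Prop :=
  ∃ f g, ultraMk u f = p ∧ ultraMk u g = q ∧ ∀ᶠ a in u, W a (f a) (g a)

theorem ultraMk_eq_iff {f g : ∀ a, Fin k → M a} :
    ultraMk u f = ultraMk u g ↔ ∀ᶠ a in u, f a = g a := by
  simp only [funext_iff (α := Fin k), Filter.eventually_all]
  exact forall_congr' fun i => Quotient.eq''

variable {u} in
theorem ultraRel_mk_iff {W : ∀ a, (Fin k → M a) → (Fin k → M a) → Prop}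
    {f g : ∀ a, Fin k → M a} :
    ultraRel u W (ultraMk u f) (ultraMk u g) ↔ ∀ᶠ a in u, W a (f a) (g a) := by
  refine ⟨?_, fun h => ⟨f, g, rfl, rfl, h⟩⟩
  rintro ⟨f', g', hf, hg, h⟩
  filter_upwards [(ultraMk_eq_iff u).1 hf, (ultraMk_eq_iff u).1 hg, h] with a hfa hga ha
  rwa [← hfa, ← hga]

theorem StronglyFirstOrder.hasImage_ultraRel_iff {D : Dependency k} (hD : StronglyFirstOrder D)
    [∀ a, Nonempty (M a)] (W : ∀ a, (Fin k → M a) → (Fin k → M a) → Prop) :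
    D.HasImage (ultraRel u W) ↔ ∀ᶠ a in u, D.HasImage (W a) := by
  obtain ⟨ψ, hψ⟩ := hD (tupleLang k) D.imageSentence D.freeVars_imageSentence
  let _ : ∀ a, (tupleLang k).Structure (M a) := fun a => tupleStructure (W a)
  have h := Ultraproduct.sentence_realize (u := u) (M := M) ψ
  have hM : ∀ a, D.HasImage (W a) ↔ Sentence.Realize (M a) ψ := fun a =>
    (D.trueIn_imageSentence (W a)).symm.trans (hψ (M a))
  simp only [hM]
  refine Iff.trans ?_ h
  refine (D.trueIn_imageSentence _).symm.trans ?_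
  have : tupleStructure (ultraRel u W) = Ultraproduct.structure := by
    refine Structure.ext (funext fun n => funext fun f => f.elim) (funext fun n => funext fun r =>
      funext fun v => ?_)
    cases r
    obtain ⟨v, rfl⟩ :
        ∃ v' : Fin (k + k) → ∀ a, M a, (fun i => (v' i : (u : Filter α).Product M)) = v :=
      ⟨fun i => (v i).out, funext fun i => Quotient.out_eq _⟩
    apply propext
    refine (ultraRel_mk_iff (f := fun a i => v (Fin.castAdd k i) a)
      (g := fun a i => v (Fin.natAdd k i) a)).trans ?_
    exact (relMap_quotient_mk' (L := tupleLang k) ((u : Filter α).productSetoid M)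
      TupleRel.rel v).symm
  rw [this]
  exact hψ _

end Ultraproduct

section

variable {k : ℕ} {D : Dependency k}

/-- For tuples indexed by a finite type, membership transfers to and from ultraproducts. -/
theorem Dependency.DomainIndependent.mem_range_ultraMk_iff (hdi : D.DomainIndependent)
    {α I : Type} [Finite I] (u : Ultrafilter α) {M : α → Type} (h : I → ∀ a, Fin k → M a) :
    D.Mem _ (Set.range fun j => ultraMk u (h j)) ↔
      ∀ᶠ a in u, D.Mem (M a) (Set.range fun j => h j a) := by
  have hker : ∀ᶠ a in u, ∀ v w : I × Fin k,
      ultraMk u (h v.1) v.2 = ultraMk u (h w.1) w.2 ↔ h v.1 a v.2 = h w.1 a w.2 := by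
    simp only [Filter.eventually_all]
    intro v w
    have hvw : ultraMk u (h v.1) v.2 = ultraMk u (h w.1) w.2 ↔
        ∀ᶠ a in u, h v.1 a v.2 = h w.1 a w.2 := Quotient.eq''
    by_cases he : ∀ᶠ a in u, h v.1 a v.2 = h w.1 a w.2
    · filter_upwards [he] with a ha using iff_of_true (hvw.2 he) ha
    · filter_upwards [Ultrafilter.eventually_not.2 he] with a ha using
        iff_of_false (mt hvw.1 he) ha
  have hiff : ∀ᶠ a in u, D.Mem _ (Set.range fun j => ultraMk u (h j)) ↔
      D.Mem (M a) (Set.range fun j => h j a) := by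
    filter_upwards [hker] with a ha
    have := hdi.mem_image_comp_iff ha (Set.range fun (j : I) (i : Fin k) => (j, i))
    simpa only [← Set.range_comp, Function.comp_def] using this
  rw [← Filter.eventually_congr hiff, Filter.eventually_const]

theorem Dependency.UnionClosed.mem_empty (huc : D.UnionClosed) (A : Type) : D.Mem A ∅ := by
  simpa using huc A Empty (fun e => e.elim) fun e => e.elim

theorem Dependency.UnionClosed.mem_union (huc : D.UnionClosed) {A : Type}
    {R S : Set (Fin k → A)} (hR : D.Mem A R) (hS : D.Mem A S) : D.Mem A (R ∪ S) := by
  rw [Set.union_eq_iUnion]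
  exact huc A Bool _ fun b => by cases b <;> assumption

namespace StronglyFirstOrder

/-- Compactness: if the union of the finite sets `W z`, `z ∈ Z`, is in `D`, then already finitely
many of them have union in `D`. -/
theorem exists_finite_biUnion_mem (hD : StronglyFirstOrder D) (hdi : D.DomainIndependent)
    {A : Type} [Nonempty A] {Z : Set (Fin k → A)} (hZ : Z.Nonempty)
    {W : (Fin k → A) → Set (Fin k → A)} (hfin : ∀ z ∈ Z, (W z).Finite)
    (hrefl : ∀ z ∈ Z, z ∈ W z) (hmem : D.Mem A (⋃ z ∈ Z, W z)) :
    ∃ X ⊆ Z, X.Finite ∧ X.Nonempty ∧ D.Mem A (⋃ z ∈ X, W z) := by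
  classical
  let u : Ultrafilter (Finset (Fin k → A)) := Ultrafilter.of Filter.atTop
  let V : Finset (Fin k → A) → (Fin k → A) → (Fin k → A) → Prop :=
    fun F z t => z ∈ F ∧ z ∈ Z ∧ t ∈ W z
  let d : A → (u : Filter (Finset (Fin k → A))).Product (fun _ => A) :=
    fun x => ((fun _ => x : Finset (Fin k → A) → A) :
      (u : Filter (Finset (Fin k → A))).Product (fun _ => A))
  have hd : d.Injective := fun x y hxy => by
    have : ∀ᶠ _ in (u : Filter (Finset (Fin k → A))), x = y := Quotient.eq''.1 hxy
    simpa using this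
  have hV : ∀ z ∈ Z, ∀ g : Finset (Fin k → A) → Fin k → A,
      ultraRel u V (fun i => d (z i)) (ultraMk u g) ↔ ∀ᶠ F in u, g F ∈ W z := by
    intro z hz g
    refine (ultraRel_mk_iff (f := fun _ => z)).trans (Filter.eventually_congr ?_)
    filter_upwards [Ultrafilter.of_le _ (Filter.eventually_ge_atTop {z})] with F hF
    simp only [V, hz, true_and, and_iff_right_iff_imp]
    exact fun _ => by simpa using hF
  have himg : D.HasImage (ultraRel u V) := by
    refine ⟨(fun z i => d (z i)) '' Z, hZ.image _, ?_, ?_⟩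
    · rintro _ ⟨z, hz, rfl⟩
      exact (hV z hz fun _ => z).2 (Filter.Eventually.of_forall fun _ => hrefl z hz)
    · convert (hdi.mem_image_iff hd _).2 hmem using 1
      ext q
      obtain ⟨g, rfl⟩ := exists_ultraMk_eq q
      constructor
      · rintro ⟨_, ⟨z, hz, rfl⟩, hq⟩
        have hg : ∀ᶠ F in u, ∃ t ∈ W z, g F = t := by simpa using (hV z hz g).1 hq
        obtain ⟨t, ht, hgt⟩ := (Ultrafilter.eventually_exists_mem_iff (hfin z hz)).1 hg
        refine ⟨t, Set.mem_biUnion hz ht, ?_⟩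
        exact ((ultraMk_eq_iff u (g := fun _ => t)).2 hgt).symm
      · rintro ⟨t, ht, htg⟩
        obtain ⟨z, hz, hzt⟩ := Set.mem_iUnion₂.1 ht
        refine ⟨_, ⟨z, hz, rfl⟩, ?_⟩
        rw [← htg]
        exact (hV z hz fun _ => t).2 (Filter.Eventually.of_forall fun _ => hzt)
  obtain ⟨F, X, hX, hXV, hXD⟩ := ((hD.hasImage_ultraRel_iff u V).1 himg).exists
  refine ⟨X, fun z hz => (hXV z hz).2.1, F.finite_toSet.subset fun z hz => (hXV z hz).1, hX, ?_⟩
  convert hXD using 1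
  ext t
  simp only [Set.mem_iUnion, exists_prop, Set.mem_ofPred_eq, V]
  exact exists_congr fun z => and_congr_right fun hz => by simp [(hXV z hz).1, (hXV z hz).2.1]

/-- Every tuple of a relation in `D` is contained in a finite subrelation in `D`. -/
theorem exists_finite_subset_mem (hD : StronglyFirstOrder D) (hdi : D.DomainIndependent)
    {A : Type} [Nonempty A] {R : Set (Fin k → A)} (hR : D.Mem A R) {t : Fin k → A} (ht : t ∈ R) :
    ∃ F ⊆ R, F.Finite ∧ t ∈ F ∧ D.Mem A F := by
  obtain ⟨X, hXR, hX, ⟨z, hz⟩, hXD⟩ := hD.exists_finite_biUnion_mem hdi ⟨t, ht⟩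
    (W := fun z => {t, z}) (fun z _ => by simp) (fun z _ => by simp) (by
      convert hR using 1
      ext v
      simp only [Set.mem_iUnion, Set.mem_insert_iff, Set.mem_singleton_iff, exists_prop]
      exact ⟨by rintro ⟨z, hz, rfl | rfl⟩ <;> assumption, fun hv => ⟨v, hv, Or.inr rfl⟩⟩)
  refine ⟨_, ?_, hX.biUnion fun z _ => Set.toFinite _, Set.mem_biUnion hz (by simp), hXD⟩
  exact Set.iUnion₂_subset fun z hz => Set.insert_subset ht (Set.singleton_subset_iff.2 (hXR hz))

/-- `D` is closed under ultraproducts of nonempty relations. -/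
theorem mem_ultraproduct (hD : StronglyFirstOrder D) {α : Type} (u : Ultrafilter α)
    {M : α → Type} [∀ a, Nonempty (M a)] {R : ∀ a, Set (Fin k → M a)}
    (hR : ∀ a, D.Mem (M a) (R a)) (hne : ∀ a, (R a).Nonempty) :
    D.Mem _ {p | ∃ f, ultraMk u f = p ∧ ∀ᶠ a in u, f a ∈ R a} := by
  obtain ⟨Z, ⟨z, hz⟩, hZ, hZD⟩ := (hD.hasImage_ultraRel_iff u
    fun a z t => z ∈ R a ∧ t ∈ R a).2 (Filter.Eventually.of_forall fun a =>
      ⟨R a, hne a, fun z hz => ⟨hz, hz⟩, by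
        convert hR a using 1
        obtain ⟨z, hz⟩ := hne a
        ext t
        exact ⟨fun ⟨_, _, _, h⟩ => h, fun h => ⟨z, hz, hz, h⟩⟩⟩)
  convert hZD using 1
  ext p
  obtain ⟨f, rfl⟩ := exists_ultraMk_eq p
  constructor
  · rintro ⟨f', hf', hf'R⟩
    obtain ⟨g, -, hg, -, hgR⟩ := hZ z hz
    obtain ⟨g, rfl⟩ := exists_ultraMk_eq z
    have hgR := ultraRel_mk_iff.1 (hZ _ hz)
    refine ⟨_, hz, ?_⟩
    rw [← hf', ultraRel_mk_iff]
    filter_upwards [hgR, hf'R] with a ha ha' using ⟨ha.1, ha'⟩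
  · rintro ⟨z, -, hzf⟩
    obtain ⟨g, rfl⟩ := exists_ultraMk_eq z
    exact ⟨f, rfl, (ultraRel_mk_iff.1 hzf).mono fun a ha => ha.2⟩

/-- Every relation in `D` has a finite core: a finite subrelation which stays in `D` on adding any
single tuple of the relation. -/
theorem exists_finite_core (hD : StronglyFirstOrder D) (hdi : D.DomainIndependent)
    (huc : D.UnionClosed) {A : Type} [Nonempty A] {R : Set (Fin k → A)} (hR : D.Mem A R) :
    ∃ F ⊆ R, F.Finite ∧ ∀ t ∈ R, D.Mem A (insert t F) := by
  by_contra! hcore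
  choose tile htileR htilefin hmem_tile htile using
    fun (t : R) => hD.exists_finite_subset_mem hdi hR t.2
  choose bad hbadR hbad using fun F : {F : Set (Fin k → A) // F ⊆ R ∧ F.Finite} =>
    hcore F F.2.1 F.2.2
  let next : {F : Set (Fin k → A) // F ⊆ R ∧ F.Finite} →
      {F : Set (Fin k → A) // F ⊆ R ∧ F.Finite} := fun F =>
        ⟨F ∪ tile ⟨bad F, hbadR F⟩, Set.union_subset F.2.1 (htileR _),
      F.2.2.union (htilefin _)⟩
  let F : ℕ → {F : Set (Fin k → A) // F ⊆ R ∧ F.Finite} :=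
    fun n => next^[n] ⟨∅, Set.empty_subset _, Set.finite_empty⟩
  let c : ℕ → Fin k → A := fun n => bad (F n)
  let G : ℕ → Set (Fin k → A) := fun n => tile ⟨c n, hbadR (F n)⟩
  have hF : ∀ n, (F (n + 1) : Set (Fin k → A)) = (F n : Set (Fin k → A)) ∪ G n := fun n => by
    simp only [F, Function.iterate_succ_apply']
    rfl
  have hFmono : Monotone fun n => (F n : Set (Fin k → A)) :=
    monotone_nat_of_le_succ fun n => by
      rw [hF]
      exact Set.subset_union_left
  have hGF : ∀ m n, m < n → G m ⊆ F n := fun m n hmn =>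
    (Set.subset_union_right.trans (hF m).ge).trans (hFmono hmn)
  have hcG : ∀ n, c n ∈ G n := fun n => hmem_tile _
  have hFD : ∀ n, D.Mem A (F n) := fun n => by
    induction n with
    | zero => exact huc.mem_empty A
    | succ n ih =>
      rw [hF]
      exact huc.mem_union ih (htile _)
  have hcF : ∀ n, c n ∉ (F n : Set (Fin k → A)) := fun n hn => by
    apply hbad (F n)
    change D.Mem A (insert (c n) _)
    rw [Set.insert_eq_of_mem hn]
    exact hFD n
  have hc : Function.Injective c :=
    Function.Injective.of_lt_imp_ne fun m n hmn h => hcF n (h ▸ hGF m n hmn (hcG m))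
  obtain ⟨X, hXc, hX, hXne, hXD⟩ := hD.exists_finite_biUnion_mem hdi (Set.range_nonempty c)
    (W := fun z => insert z {t | ∃ m, c (m + 1) = z ∧ t ∈ G m}) (by
      rintro _ ⟨n, rfl⟩
      refine Set.Finite.insert _ ((htilefin ⟨c (n - 1), hbadR _⟩).subset ?_)
      rintro t ⟨m, hm, ht⟩
      obtain rfl := hc hm
      exact ht) (fun z _ => Set.mem_insert _ _) (by
      convert huc A ℕ G (fun n => htile _) using 1
      ext t
      simp only [Set.mem_iUnion, Set.mem_range, Set.mem_insert_iff, Set.mem_ofPred_eq]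
      constructor
      · rintro ⟨_, ⟨n, rfl⟩, rfl | ⟨m, -, ht⟩⟩
        · exact ⟨n, hcG n⟩
        · exact ⟨m, ht⟩
      · rintro ⟨m, ht⟩
        exact ⟨_, ⟨m + 1, rfl⟩, Or.inr ⟨m, rfl, ht⟩⟩)
  obtain ⟨N, hNX, hN⟩ := Set.exists_max_image (c ⁻¹' X) id (hX.preimage hc.injOn) (by
    obtain ⟨z, hz⟩ := hXne
    obtain ⟨n, rfl⟩ := hXc hz
    exact ⟨n, hz⟩)
  apply hbad (F N)
  convert huc.mem_union (hFD N) hXD using 1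
  ext t
  simp only [Set.mem_union, Set.mem_iUnion, Set.mem_insert_iff, Set.mem_ofPred_eq, exists_prop]
  constructor
  · rintro (rfl | ht)
    · exact Or.inr ⟨_, hNX, Or.inl rfl⟩
    · exact Or.inl ht
  · rintro (ht | ⟨z, hz, rfl | ⟨m, rfl, ht⟩⟩)
    · exact Or.inr ht
    · obtain ⟨n, rfl⟩ := hXc hz
      rcases (hN n hz).eq_or_lt with h | h
      · exact Or.inl (congrArg c h)
      · exact Or.inr (hGF n N h (hcG n))
    · exact Or.inr (hGF m N (hN (m + 1) hz) ht)

end StronglyFirstOrder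

/-- A core of size `m` can be padded to any larger size. -/
theorem Dependency.UnionClosed.exists_core_of_le (huc : D.UnionClosed) {A : Type}
    {R : Set (Fin k → A)} (hne : R.Nonempty) {m n : ℕ} (hmn : m ≤ n)
    (h : ∃ f : Fin m → Fin k → A, (∀ j, f j ∈ R) ∧
      ∀ t ∈ R, D.Mem A (insert t (Set.range f))) :
    ∃ f : Fin n → Fin k → A, (∀ j, f j ∈ R) ∧ ∀ t ∈ R, D.Mem A (insert t (Set.range f)) := by
  induction n, hmn using Nat.le_induction with
  | base => exact h
  | succ n _ ih =>
    obtain ⟨f, hf, hfD⟩ := ih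
    obtain ⟨t₀, ht₀⟩ := hne
    refine ⟨Fin.cons t₀ f, Fin.cases ht₀ hf, fun t ht => ?_⟩
    rw [Fin.range_cons]
    convert huc.mem_union (hfD t ht) (hfD t₀ ht₀) using 1
    ext
    simp only [Set.mem_union, Set.mem_insert_iff]
    tauto

/-- Relations in `D` have cores of uniformly bounded size. -/
theorem StronglyFirstOrder.exists_uniform_core (hD : StronglyFirstOrder D)
    (hdi : D.DomainIndependent) (huc : D.UnionClosed) :
    ∃ N : ℕ, ∀ (A : Type) [Nonempty A] (R : Set (Fin k → A)), D.Mem A R → R.Nonempty →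
      ∃ f : Fin N → Fin k → A, (∀ j, f j ∈ R) ∧ ∀ t ∈ R, D.Mem A (insert t (Set.range f)) := by
  by_contra! hcon
  choose A hA R hR hne hbad using hcon
  let u : Ultrafilter ℕ := Filter.hyperfilter ℕ
  have hnonempty : Nonempty ((u : Filter ℕ).Product A) := inferInstance
  obtain ⟨F, hFR, hFfin, hF⟩ := hD.exists_finite_core hdi huc (hD.mem_ultraproduct u hR hne)
  obtain ⟨m, f, rfl⟩ := hFfin.fin_embedding
  choose g hg hgR using fun j => hFR (Set.mem_range_self j)
  have hc : ∀ᶠ n in u, ∃ c ∈ R n, ¬ D.Mem (A n) (insert c (Set.range fun j => g j n)) := by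
    filter_upwards [Filter.eventually_all.2 hgR,
      Nat.hyperfilter_le_atTop (Filter.eventually_ge_atTop m)] with n hn hmn
    by_contra! h
    obtain ⟨f', hf', hf'D⟩ := huc.exists_core_of_le (hne n) hmn ⟨fun j => g j n, hn, h⟩
    obtain ⟨c, hc, hcD⟩ := hbad n f' hf'
    exact hcD (hf'D c hc)
  have : ∃ c : ∀ n, Fin k → A n, ∀ᶠ n in u, c n ∈ R n ∧
      ¬ D.Mem (A n) (insert (c n) (Set.range fun j => g j n)) := by
    classical
    refine ⟨fun n => if h : ∃ c ∈ R n, ¬ D.Mem (A n) (insert c (Set.range fun j => g j n))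
      then h.choose else fun _ => Classical.arbitrary _, hc.mono fun n hn => ?_⟩
    simpa only [hn, dite_true] using hn.choose_spec
  obtain ⟨c, hc⟩ := this
  have hmem := hF (ultraMk u c) ⟨c, rfl, hc.mono fun n hn => hn.1⟩
  have hcons : ∀ {β : Type} (e : (∀ n, Fin k → A n) → β),
      Set.range (fun j => e ((Fin.cons c g : Fin (m + 1) → ∀ n, Fin k → A n) j)) =
        insert (e c) (Set.range fun j => e (g j)) := fun e => by
    rw [← Function.comp_def e, Set.range_comp, Fin.range_cons, Set.image_insert_eq,
      ← Set.range_comp]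
    rfl
  simp only [← funext hg] at hmem
  rw [← hcons, hdi.mem_range_ultraMk_iff] at hmem
  obtain ⟨n, hn, hn'⟩ := (hmem.and hc).exists
  exact hn'.2 (hcons (fun h => h n) ▸ hn)

end

namespace CNFormula

/-- A formula satisfied by every team. -/
def verum : CNFormula L := .fa 0 (.equal (Term.var 0) (Term.var 0))

/-- A formula satisfied by the empty team only. -/
def falsum : CNFormula L := .fa 0 (.nequal (Term.var 0) (Term.var 0))

/-- Finite conjunctions. -/
def listConj (l : List (CNFormula L)) : CNFormula L := l.foldr .conj verum

section

variable {M : Type} [L.Structure M] {X : Set (ℕ → M)}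

@[simp] theorem sat_verum : (verum : CNFormula L).Sat M X := fun _ _ => rfl

@[simp] theorem sat_falsum [Nonempty M] : (falsum : CNFormula L).Sat M X ↔ X = ∅ := by
  refine ⟨fun h => Set.eq_empty_of_forall_notMem fun s hs => ?_, ?_⟩
  · exact h _ ⟨s, hs, Classical.arbitrary M, rfl⟩ rfl
  · rintro rfl t ⟨s, hs, -⟩
    exact hs.elim

@[simp] theorem sat_listConj {l : List (CNFormula L)} :
    (listConj l).Sat M X ↔ ∀ φ ∈ l, φ.Sat M X := by
  induction l with
  | nil => simp [listConj]
  | cons φ l ih => rw [List.forall_mem_cons, ← ih]; rfl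

end

@[simp] theorem freeVars_verum : (verum : CNFormula L).freeVars = ∅ := by
  simp [verum, freeVars, cnTermVars]

@[simp] theorem freeVars_falsum : (falsum : CNFormula L).freeVars = ∅ := by
  simp [falsum, freeVars, cnTermVars]

theorem freeVars_listConj_subset {l : List (CNFormula L)} {S : Set ℕ}
    (h : ∀ φ ∈ l, φ.freeVars ⊆ S) : (listConj l).freeVars ⊆ S := by
  induction l with
  | nil => simp [listConj]
  | cons φ l ih =>
    rw [List.forall_mem_cons] at h
    exact Set.union_subset h.1 (ih h.2)

/-- The equality pattern of the first `q` variables is expressible. -/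
theorem exists_sat_iff_forall_pattern_eq (q : ℕ) (e : Fin q → Fin q → Prop) :
    ∃ φ : CNFormula L, φ.freeVars ⊆ {n | n < q} ∧ ∀ (M : Type) [L.Structure M] (X : Set (ℕ → M)),
      φ.Sat M X ↔ ∀ s ∈ X, (fun i j : Fin q => s i = s j) = e := by
  classical
  refine ⟨listConj ((Finset.univ : Finset (Fin q × Fin q)).toList.map fun p =>
    if e p.1 p.2 then .equal (Term.var p.1) (Term.var p.2)
    else .nequal (Term.var p.1) (Term.var p.2)), freeVars_listConj_subset ?_, fun M _ X => ?_⟩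
  · simp only [List.mem_map, Finset.mem_toList, Finset.mem_univ, true_and]
    rintro _ ⟨p, rfl⟩
    split_ifs <;> simp [freeVars, cnTermVars, Set.insert_subset_iff]
  · simp only [sat_listConj, List.forall_mem_map, Finset.mem_toList, Finset.mem_univ,
      forall_true_left, funext_iff, eq_iff_iff]
    constructor
    · intro h s hs i j
      have := h (i, j)
      split_ifs at this with hij
      · exact iff_of_true (this s hs) hij
      · exact iff_of_false (this s hs) hij
    · rintro h ⟨i, j⟩
      split_ifs with hij
      · exact fun s hs => (h s hs i j).2 hij
      · exact fun s hs => mt (h s hs i j).1 hij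

/-- Any property of the equality pattern of the first `q` variables is expressible. -/
theorem exists_sat_iff_forall_pattern_mem (q : ℕ) (E : Set (Fin q → Fin q → Prop)) :
    ∃ φ : CNFormula L, φ.freeVars ⊆ {n | n < q} ∧
      ∀ (M : Type) [L.Structure M] [Nonempty M] (X : Set (ℕ → M)),
        φ.Sat M X ↔ ∀ s ∈ X, (fun i j : Fin q => s i = s j) ∈ E := by
  induction E, E.toFinite using Set.Finite.induction_on with
  | empty =>
    exact ⟨falsum, by simp, fun M _ _ X => by simp [Set.eq_empty_iff_forall_notMem]⟩
  | @insert e E _ _ ih =>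
    obtain ⟨φ, hφ, hφE⟩ := ih
    obtain ⟨ψ, hψ, hψe⟩ := exists_sat_iff_forall_pattern_eq (L := L) q e
    refine ⟨.disj ψ φ, Set.union_subset hψ hφ, fun M _ _ X => ?_⟩
    simp only [Sat, hφE, hψe, Set.mem_insert_iff]
    constructor
    · rintro ⟨Y, Z, rfl, hY, hZ⟩ s hs
      exact hs.imp (hY s) (hZ s)
    · intro h
      refine ⟨_, _, (Set.sep_or.symm.trans (Set.sep_eq_self_iff_mem_true.2 h)).symm,
        fun s hs => hs.2, fun s hs => hs.2⟩

theorem exists_sat_iff_forall_mem {k : ℕ} {D : Dependency k} (hdi : D.DomainIndependent) {q : ℕ}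
    (Γ : Set (Fin k → Fin q)) :
    ∃ φ : CNFormula L, φ.freeVars ⊆ {n | n < q} ∧
      ∀ (M : Type) [L.Structure M] [Nonempty M] (X : Set (ℕ → M)),
        φ.Sat M X ↔ ∀ s ∈ X, D.Mem M ((fun γ (i : Fin k) => s (γ i)) '' Γ) := by
  obtain ⟨φ, hφ, h⟩ := exists_sat_iff_forall_pattern_mem (L := L) q
    {e | ∃ (A : Type) (s : Fin q → A), (fun i j => s i = s j) = e ∧
      D.Mem A ((fun γ => s ∘ γ) '' Γ)}
  refine ⟨φ, hφ, fun M _ _ X => (h M X).trans (forall₂_congr fun s _ => ⟨?_, fun hs => ?_⟩)⟩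
  · rintro ⟨A, s', hs', hD⟩
    have hker : ∀ i j, s' i = s' j ↔ (fun i : Fin q => s i) i = (fun i : Fin q => s i) j :=
      fun i j => iff_of_eq (congrFun (congrFun hs' i) j)
    exact (hdi.mem_image_comp_iff hker Γ).1 hD
  · exact ⟨M, fun i => s i, rfl, hs⟩

/-- Nonempty teams satisfying the formula contain an assignment at which the tuples of variables
`xs` and `ys` have the same value. -/
def existsEq {k : ℕ} (xs ys : Fin k → ℕ) : CNFormula L :=
  .disj (.conj (.neAtom 0 Fin.elim0)
    (listConj (List.ofFn fun i => .equal (Term.var (xs i)) (Term.var (ys i))))) verum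

theorem sat_existsEq {k : ℕ} {xs ys : Fin k → ℕ} {M : Type} [L.Structure M] {X : Set (ℕ → M)} :
    (existsEq xs ys : CNFormula L).Sat M X ↔ ∃ s ∈ X, ∀ i, s (xs i) = s (ys i) := by
  simp only [existsEq, Sat, sat_listConj, List.forall_mem_ofFn_iff, Term.realize_var, sat_verum,
    and_true]
  constructor
  · rintro ⟨Y, Z, rfl, ⟨_, s, hs, -⟩, h⟩
    exact ⟨s, Or.inl hs, fun i => h i s hs⟩
  · rintro ⟨s, hs, h⟩
    refine ⟨{s}, X, by simp [hs], ⟨_, s, rfl, rfl⟩, ?_⟩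
    rintro i _ rfl
    exact h i

theorem freeVars_existsEq_subset {k : ℕ} {xs ys : Fin k → ℕ} {S : Set ℕ} (hxs : ∀ i, xs i ∈ S)
    (hys : ∀ i, ys i ∈ S) : (existsEq xs ys : CNFormula L).freeVars ⊆ S := by
  refine Set.union_subset (Set.union_subset ?_ (freeVars_listConj_subset ?_)) (by simp)
  · rintro _ ⟨i, -⟩
    exact i.elim0
  · rw [List.forall_mem_ofFn_iff]
    intro i
    simp [freeVars, cnTermVars, Set.insert_subset_iff, hxs, hys]

end CNFormula

/-- If nonempty relations in `D` have cores of bounded size, then `D` is definable: guess a core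
as the value of constant tuples of variables. -/
theorem Dependency.DomainIndependent.exists_definition {k : ℕ} {D : Dependency k}
    (hdi : D.DomainIndependent) (huc : D.UnionClosed) {N : ℕ}
    (hN : ∀ (A : Type) [Nonempty A] (R : Set (Fin k → A)), D.Mem A R → R.Nonempty →
      ∃ f : Fin N → Fin k → A, (∀ j, f j ∈ R) ∧ ∀ t ∈ R, D.Mem A (insert t (Set.range f))) :
    ∃ φ : CNFormula Language.empty, φ.freeVars ⊆ Set.range (fun i : Fin k => (i : ℕ)) ∧
      ∀ (M : Type) [Nonempty M] (X : Set (ℕ → M)),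
        D.Mem M (teamMap X (fun i : Fin k => (i : ℕ))) ↔ φ.Sat M X := by
  let core : Fin N → Fin k → Fin (k + N * k) := fun j i => Fin.natAdd k (finProdFinEquiv (j, i))
  let vs : List ℕ := (List.range (N * k)).map (k + ·)
  have hvs : ∀ n, n ∈ vs ↔ ∃ p : Fin (N * k), k + p = n := fun n => by
    simp only [vs, List.mem_map, List.mem_range]
    exact ⟨fun ⟨p, hp, h⟩ => ⟨⟨p, hp⟩, h⟩, fun ⟨p, h⟩ => ⟨p, p.2, h⟩⟩
  have hlt : ∀ i : Fin k, (i : ℕ) ∉ vs := fun i => by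
    rw [hvs]
    rintro ⟨p, hp⟩
    omega
  obtain ⟨θ, hθvars, hθ⟩ := CNFormula.exists_sat_iff_forall_mem (L := Language.empty) hdi
    (insert (Fin.castAdd (N * k)) (Set.range core))
  have hθ' : ∀ (M : Type) [Nonempty M] (X : Set (ℕ → M)), θ.Sat M X ↔ ∀ s ∈ X,
      D.Mem M (insert (fun i : Fin k => s i) (Set.range fun j i => s (core j i))) :=
    fun M _ X => by
      rw [hθ]
      simp only [Set.image_insert_eq, ← Set.range_comp, Function.comp_def, Fin.val_castAdd]
  let member : Fin N → CNFormula Language.empty := fun j =>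
    .existsEq (fun i => (i : ℕ)) (fun i => (core j i : ℕ))
  refine ⟨.glob .falsum (vs.foldr .ex (.conj (.constancy (N * k) fun p => k + (p : ℕ))
    (.conj (.listConj (List.ofFn member)) θ))), ?_, fun M _ X => ?_⟩
  · have hvars : CNFormula.freeVars (.conj (.constancy (N * k) fun p => k + (p : ℕ))
        (.conj (.listConj (List.ofFn member)) θ)) ⊆ {n | n < k + N * k} := by
      refine Set.union_subset ?_ (Set.union_subset (CNFormula.freeVars_listConj_subset ?_) hθvars)
      · rintro _ ⟨p, rfl⟩
        exact Nat.add_lt_add_left p.2 k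
      · rw [List.forall_mem_ofFn_iff]
        exact fun j => CNFormula.freeVars_existsEq_subset
          (fun i => Nat.lt_add_right _ i.2) fun i => (core j i).2
    rw [CNFormula.freeVars, CNFormula.freeVars_falsum, CNFormula.freeVars_foldr_ex, Set.empty_union]
    rintro n ⟨hn, hnvs⟩
    have hn := hvars hn
    by_contra hnk
    have hkn : k ≤ n := by
      by_contra! h
      exact hnk ⟨⟨n, h⟩, rfl⟩
    exact hnvs ((hvs n).2 ⟨⟨n - k, by simp only [Set.mem_ofPred_eq] at hn; omega⟩,
      Nat.add_sub_cancel' hkn⟩)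
  · simp only [CNFormula.Sat, CNFormula.sat_falsum, CNFormula.sat_foldr_ex, CNFormula.sat_listConj,
      List.forall_mem_ofFn_iff, member, CNFormula.sat_existsEq, hθ']
    rcases X.eq_empty_or_nonempty with rfl | hX
    · have : teamMap (∅ : Set (ℕ → M)) (fun i : Fin k => (i : ℕ)) = ∅ := by simp [teamMap]
      simp [this, huc.mem_empty]
    simp only [hX.ne_empty, false_or]
    constructor
    · intro hD
      obtain ⟨s₀, hs₀⟩ := hX
      obtain ⟨f, hfX, hf⟩ := hN M _ hD ⟨_, s₀, hs₀, rfl⟩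
      have hex : ∀ s : ℕ → M, ∃ t : ℕ → M, (∀ n ∉ vs, t n = s n) ∧ ∀ j i, t (core j i) = f j i :=
        fun s => by
        refine ⟨fun n => if h : k ≤ n ∧ n - k < N * k then
          f (finProdFinEquiv.symm ⟨n - k, h.2⟩).1 (finProdFinEquiv.symm ⟨n - k, h.2⟩).2 else s n,
          fun n hn => dif_neg fun h => hn ((hvs n).2 ⟨⟨n - k, h.2⟩, Nat.add_sub_cancel' h.1⟩),
          fun j i => ?_⟩
        have h : k ≤ (core j i : ℕ) ∧ (core j i : ℕ) - k < N * k := by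
          simp only [core, Fin.val_natAdd]
          omega
        have h' : (⟨(core j i : ℕ) - k, h.2⟩ : Fin (N * k)) = finProdFinEquiv (j, i) :=
          Fin.ext (Nat.add_sub_cancel_left k _)
        simp only [h, and_self, dite_true, h', Equiv.symm_apply_apply]
      have hw : ∀ s t : ℕ → M, (∀ n ∉ vs, t n = s n) →
          (fun i : Fin k => t i) = fun i : Fin k => s i := fun s t h =>
        funext fun i => h i (hlt i)
      refine ⟨{t | (∃ s ∈ X, ∀ n ∉ vs, t n = s n) ∧ ∀ j i, t (core j i) = f j i},
        ⟨fun s hs => ?_, fun t ht => ht.1⟩, fun t ht t' ht' p => ?_, fun j => ?_, fun t ht => ?_⟩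
      · obtain ⟨t, hts, htf⟩ := hex s
        exact ⟨t, ⟨⟨s, hs, hts⟩, htf⟩, hts⟩
      · obtain ⟨⟨j, i⟩, rfl⟩ := finProdFinEquiv.surjective p
        exact (ht.2 j i).trans (ht'.2 j i).symm
      · obtain ⟨s, hs, hsf⟩ := hfX j
        obtain ⟨t, hts, htf⟩ := hex s
        refine ⟨t, ⟨⟨s, hs, hts⟩, htf⟩, fun i => ?_⟩
        rw [htf, hsf]
        exact hts i (hlt i)
      · obtain ⟨⟨s, hs, hts⟩, htf⟩ := ht
        simp only [hw s t hts, htf]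
        exact hf _ ⟨s, hs, rfl⟩
    · rintro ⟨Y, hY, hconst, hmem, hD⟩
      convert huc M Y (fun t => insert (fun i : Fin k => (t : ℕ → M) i)
        (Set.range fun j i => (t : ℕ → M) (core j i))) fun t => hD t t.2 using 1
      ext v
      simp only [Set.mem_iUnion, Set.mem_insert_iff, Set.mem_range, Subtype.exists, exists_prop]
      constructor
      · rintro ⟨s, hs, rfl⟩
        obtain ⟨t, ht, hts⟩ := hY.1 s hs
        exact ⟨t, ht, Or.inl (funext fun i => (hts i (hlt i)).symm)⟩
      · have hYX : ∀ t ∈ Y, (fun i : Fin k => t i) ∈ teamMap X (fun i : Fin k => (i : ℕ)) :=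
          fun t ht => by
          obtain ⟨s, hs, hts⟩ := hY.2 t ht
          exact ⟨s, hs, funext fun i => hts i (hlt i)⟩
        rintro ⟨t, ht, rfl | ⟨j, rfl⟩⟩
        · exact hYX t ht
        · obtain ⟨r, hr, hrj⟩ := hmem j
          convert hYX r hr using 1
          funext i
          rw [hrj i]
          exact hconst t ht r hr (finProdFinEquiv (j, i))

/-- **Characterization of union-closed strongly first order dependencies.** A domain-independent,
union-closed `k`-ary dependency `D` is strongly first order iff it is definable in terms of
constancy atoms, nonemptiness atoms and global disjunctions: iff there is a formula `φ(w⃗)` of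
`FO(=(·), NE, ⊔)` over the empty signature, with free variables among the `k`-tuple of distinct
variables `w⃗ = (0, …, k-1)`, such that for all models `M` and teams `X` whose domain contains
`w⃗`: `M ⊨_X D w⃗` iff `M ⊨_X φ(w⃗)`. -/
theorem unionClosed_stronglyFirstOrder_iff_definable {k : ℕ} (D : Dependency k)
    (hdi : D.DomainIndependent) (huc : D.UnionClosed) :
    StronglyFirstOrder D ↔
      ∃ φ : CNFormula FirstOrder.Language.empty,
        CNFormula.freeVars φ ⊆ Set.range (fun i : Fin k => (i : ℕ)) ∧
        ∀ (M : Type) [Nonempty M] (X : Set (ℕ → M)),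
          (D.Mem M (teamMap X (fun i : Fin k => (i : ℕ))) ↔ CNFormula.Sat M φ X) := by
  refine ⟨fun hD => ?_, fun ⟨φ, _, hφ⟩ => Dependency.stronglyFirstOrder_of_definable hφ⟩
  obtain ⟨N, hN⟩ := hD.exists_uniform_core hdi huc
  exact hdi.exists_definition huc hN
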